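/- arXiv:2410.09060 — 4 statements merged into one kernel-verified Lean document; each statement's English description precedes it below -/
import Mathlib

section
/- For every n ∈ ℕ, every choice of nodes x_0, …, x_{n−1} ∈ [0,1) and real coefficients c_0, …, c_{n−1}, and every δ ∈ (0, 1/2), there exists a function g : [0,1) → ℝ which is either the constant function g ≡ 1 (in which case set W(g) = 1) or g(x) = 1 − cos(2πqx) for some positive integer q (in which case set W(g) = 2), such that |1 − ∑_{h=0}^{n−1} c_h g(x_h)| ≥ (1/2 − δ)·W(g). (Here ∫_0^1 g(x) dx = 1 in both cases, and W(g) equals the Wiener-algebra norm ∑_{k∈ℤ} |ĝ(k)| of g, so this shows any linear quadrature rule has worst-case error at least 1/2 on the unit ball of the Wiener algebra.) -/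
open scoped Real

/-- Simultaneous recurrence of a finite family of characters: any weighted sum of the functions
`1 - cos (2πqx)` over finitely many nodes can be made arbitrarily small by choosing `q > 0`. -/
theorem exists_pos_abs_sum_mul_one_sub_cos_lt {ι : Type*} [Fintype ι] (x c : ι → ℝ) {ε : ℝ}
    (hε : 0 < ε) :
    ∃ q : ℕ, 0 < q ∧ |∑ h, c h * (1 - Real.cos (2 * π * q * x h))| < ε := by
  let z : ι → Circle := fun h => Circle.exp (2 * π * x h)
  let f : (ι → Circle) → ℝ := fun w => |∑ h, c h * (1 - (w h : ℂ).re)|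
  have hf : Continuous f := by
    refine continuous_abs.comp (continuous_finsetSum _ fun h _ => ?_)
    exact continuous_const.mul (continuous_const.sub
      (Complex.continuous_re.comp (continuous_subtype_val.comp (continuous_apply h))))
  have hmem : {w | f w < ε} ∈ nhds (1 : ι → Circle) :=
    (isOpen_lt hf continuous_const).mem_nhds (by simpa [f] using hε)
  obtain ⟨q, hq, hq0⟩ := (((mapClusterPt_one_atTop_pow z).frequently hmem).and_eventually
    (Filter.eventually_gt_atTop 0)).exists
  refine ⟨q, hq0, ?_⟩
  have hre (h : ι) : (((z ^ q) h : Circle) : ℂ).re = Real.cos (2 * π * q * x h) := by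
    simp only [z, Pi.pow_apply, ← Circle.exp_nsmul, Circle.coe_exp, Complex.exp_ofReal_mul_I_re]
    congr 1
    simp only [nsmul_eq_mul]
    ring
  have hlt : f (z ^ q) < ε := hq
  simpa only [f, hre] using hlt

/-- any linear quadrature rule has a fooling function (constant `1`
or `1 - cos (2πqx)`) witnessing worst-case error at least `1/2 - δ` times the
Wiener-algebra norm. -/
theorem stmt_0 (n : ℕ) (x : Fin n → ℝ) (hx : ∀ h, x h ∈ Set.Ico (0:ℝ) 1)
    (c : Fin n → ℝ) (δ : ℝ) (hδ : δ ∈ Set.Ioo (0:ℝ) (1/2)) :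
    ∃ (g : ℝ → ℝ) (W : ℝ),
      (((g = fun _ => 1) ∧ W = 1) ∨
        (∃ q : ℕ, 0 < q ∧ (g = fun t => 1 - Real.cos (2 * π * q * t)) ∧ W = 2)) ∧
      (1/2 - δ) * W ≤ |1 - ∑ h, c h * g (x h)| := by
  obtain ⟨q, hq, hlt⟩ := exists_pos_abs_sum_mul_one_sub_cos_lt x c (ε := 2 * δ)
    (mul_pos two_pos hδ.1)
  refine ⟨fun t => 1 - Real.cos (2 * π * q * t), 2, Or.inr ⟨q, hq, rfl, rfl⟩, ?_⟩
  exact le_abs.2 (Or.inl (by linarith [(abs_lt.1 hlt).2]))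
end

section
/- Let n ≥ 1, let x_0, …, x_{n−1} ∈ [0,1) and c_0, …, c_{n−1} ∈ ℝ be arbitrary. Then there exists a function g : [0,1) → ℝ which is either the constant function g ≡ 1 (with weighted norm ‖g‖ = 1) or g(x) = 1 − cos(2πqx) for some positive integer q (with weighted norm ‖g‖ = 1 + max(1, log log q)), such that |1 − ∑_{h=0}^{n−1} c_h g(x_h)| ≥ [(2/3)/(1 + max(1, log(n·log 6)))]·‖g‖. Consequently, for the weight r_0(k) = max(1, log log |k|), any quadrature rule with worst-case error at most ε ∈ (0,1) on the unit ball of the corresponding weighted Wiener space must use at least (1/log 6)·exp(2ε^{−1}/3 − 1) nodes. -/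
open scoped Real

theorem Matrix.IsHermitian.trace_mul_self_eq_sum_sq_eigenvalues {ι : Type*} [Fintype ι]
    [DecidableEq ι] {A : Matrix ι ι ℂ} (hA : A.IsHermitian) :
    (A * A).trace = ∑ i, ((hA.eigenvalues i : ℝ) : ℂ) ^ 2 := by
  conv_lhs => rw [hA.spectral_theorem, ← map_mul, Unitary.conjStarAlgAut_apply,
    Matrix.trace_mul_cycle]
  simp [Matrix.diagonal_mul_diagonal, Matrix.trace_diagonal, pow_two]

theorem Matrix.IsHermitian.re_trace_sq_le_rank_mul {ι : Type*} [Fintype ι]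
    [DecidableEq ι] {A : Matrix ι ι ℂ} (hA : A.IsHermitian) :
    A.trace.re ^ 2 ≤ A.rank * ∑ i, ∑ j, ‖A i j‖ ^ 2 := by
  have h1 : A.trace.re = ∑ i, hA.eigenvalues i := by
    rw [hA.trace_eq_sum_eigenvalues]; simp
  have h2 : ∑ i, ∑ j, ‖A i j‖ ^ 2 = ∑ i, hA.eigenvalues i ^ 2 := by
    have h := hA.trace_mul_self_eq_sum_sq_eigenvalues
    have h' : (A * A).trace = ((∑ i, ∑ j, ‖A i j‖ ^ 2 : ℝ) : ℂ) := by
      simp only [Matrix.trace, Matrix.diag, Matrix.mul_apply]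
      push_cast
      refine Finset.sum_congr rfl fun i _ => Finset.sum_congr rfl fun j _ => ?_
      rw [← hA.apply j i]
      exact Complex.mul_conj' _
    rw [h'] at h
    exact_mod_cast h
  have h3 : (A.rank : ℝ) = (Finset.univ.filter fun i => hA.eigenvalues i ≠ 0).card := by
    rw [hA.rank_eq_card_non_zero_eigs, Fintype.card_subtype]
  rw [h1, h2, h3, ← Finset.sum_filter_ne_zero]
  refine sq_sum_le_card_mul_sum_sq.trans ?_
  exact mul_le_mul_of_nonneg_left (Finset.sum_le_sum_of_subset_of_nonneg
    (Finset.filter_subset _ _) fun i _ _ => sq_nonneg (hA.eigenvalues i)) (Nat.cast_nonneg _)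

/-- Delannoy numbers. -/
def delannoy : ℕ → ℕ → ℕ
  | 0, _ => 1
  | _ + 1, 0 => 1
  | n + 1, m + 1 => delannoy n (m + 1) + delannoy (n + 1) m + delannoy n m

/-- The integer points of the `ℓ¹`-ball of radius `m` in dimension `n`. -/
noncomputable def latticeBall (n m : ℕ) : Finset (Fin n → ℤ) :=
  (Fintype.piFinset fun _ => Finset.Icc (-(m : ℤ)) m).filter fun j => ∑ h, (j h).natAbs ≤ m

theorem mem_latticeBall {n m : ℕ} {j : Fin n → ℤ} :
    j ∈ latticeBall n m ↔ ∑ h, (j h).natAbs ≤ m := by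
  simp only [latticeBall, Finset.mem_filter, Fintype.mem_piFinset, Finset.mem_Icc,
    and_iff_right_iff_imp]
  intro hj h
  have := (Finset.single_le_sum (f := fun h => (j h).natAbs) (fun _ _ => Nat.zero_le _)
    (Finset.mem_univ h)).trans hj
  omega

theorem card_latticeBall_le (n m : ℕ) : (latticeBall n m).card ≤ delannoy n m := by
  induction n, m using delannoy.induct with
  | case1 m =>
    rw [delannoy]
    exact Finset.card_le_one_of_subsingleton _
  | case2 n =>
    rw [delannoy, Finset.card_le_one]
    intro a ha b hb
    simp only [mem_latticeBall, nonpos_iff_eq_zero, Finset.sum_eq_zero_iff, Finset.mem_univ,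
      true_implies, Int.natAbs_eq_zero] at ha hb
    ext i
    rw [ha, hb]
  | case3 n m ih1 ih2 ih3 =>
    have key : latticeBall (n + 1) (m + 1) ⊆
        ((latticeBall n (m + 1)).image (Fin.cons 0) ∪
          (latticeBall (n + 1) m).image
            (fun j => Fin.cons (if 0 ≤ j 0 then j 0 + 1 else j 0 - 1) (Fin.tail j))) ∪
          (latticeBall n m).image (Fin.cons (-1)) := by
      intro j hj
      rw [mem_latticeBall, Fin.sum_univ_succ] at hj
      simp only [Finset.mem_union, Finset.mem_image, mem_latticeBall]
      rcases lt_trichotomy (j 0) 0 with h | h | h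
      · by_cases h' : j 0 = -1
        · refine Or.inr ⟨Fin.tail j, ?_, ?_⟩
          · simp only [Fin.tail]
            omega
          · rw [← h', Fin.cons_self_tail]
        · refine Or.inl (Or.inr ⟨Fin.cons (j 0 + 1) (Fin.tail j), ?_, ?_⟩)
          · rw [Fin.sum_univ_succ]
            simp only [Fin.cons_zero, Fin.cons_succ, Fin.tail]
            omega
          · have : ¬ 0 ≤ j 0 + 1 := by omega
            simp [this]
      · refine Or.inl (Or.inl ⟨Fin.tail j, ?_, ?_⟩)
        · simp only [Fin.tail]
          omega
        · rw [← h, Fin.cons_self_tail]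
      · refine Or.inl (Or.inr ⟨Fin.cons (j 0 - 1) (Fin.tail j), ?_, ?_⟩)
        · rw [Fin.sum_univ_succ]
          simp only [Fin.cons_zero, Fin.cons_succ, Fin.tail]
          omega
        · have : 1 ≤ j 0 := by omega
          simp [this]
    rw [delannoy]
    refine (Finset.card_le_card key).trans ?_
    refine (Finset.card_union_le _ _).trans (Nat.add_le_add ?_ (Finset.card_image_le.trans ih3))
    exact (Finset.card_union_le _ _).trans
      (Nat.add_le_add (Finset.card_image_le.trans ih1) (Finset.card_image_le.trans ih2))

theorem delannoy_le (n m : ℕ) : (delannoy n m : ℝ) ≤ (5 / 2) ^ m * (7 / 3) ^ n := by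
  induction n, m using delannoy.induct with
  | case1 m => simpa [delannoy] using one_le_pow₀ (by norm_num : (1 : ℝ) ≤ 5 / 2)
  | case2 n => simpa [delannoy] using one_le_pow₀ (by norm_num : (1 : ℝ) ≤ 7 / 3)
  | case3 n m ih1 ih2 ih3 =>
    rw [delannoy]
    push_cast
    calc _ ≤ (5 / 2 : ℝ) ^ (m + 1) * (7 / 3) ^ n + (5 / 2) ^ m * (7 / 3) ^ (n + 1) +
          (5 / 2) ^ m * (7 / 3) ^ n := by gcongr
      _ = _ := by rw [Nat.succ_eq_add_one, Nat.succ_eq_add_one]; ring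


/-- The character of `ℤ` with frequency `∑ h, j h * x h`. -/
noncomputable def latticeChar {n : ℕ} (x : Fin n → ℝ) (j : Fin n → ℤ) (q : ℤ) : ℂ :=
  Complex.exp (2 * π * Complex.I * q * ∑ h, (j h : ℂ) * x h)

theorem latticeChar_zero {n : ℕ} (x : Fin n → ℝ) : latticeChar x 0 = 1 := by
  ext q
  simp [latticeChar]

theorem latticeChar_add {n : ℕ} (x : Fin n → ℝ) (i j : Fin n → ℤ) :
    latticeChar x (i + j) = latticeChar x i * latticeChar x j := by
  ext q
  simp only [latticeChar, Pi.mul_apply, ← Complex.exp_add, Pi.add_apply, Int.cast_add, add_mul,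
    Finset.sum_add_distrib, mul_add]

theorem latticeChar_sub_apply {n : ℕ} (x : Fin n → ℝ) (j : Fin n → ℤ) (p q : ℤ) :
    latticeChar x j (p - q) = latticeChar x j p * latticeChar x j (-q) := by
  simp only [latticeChar, ← Complex.exp_add]
  congr 1
  push_cast
  ring

theorem latticeChar_single_add_neg {n : ℕ} (x : Fin n → ℝ) (h : Fin n) (q : ℤ) :
    latticeChar x (Pi.single h 1) q + latticeChar x (Pi.single h (-1)) q =
      2 * (Real.cos (2 * π * q * x h) : ℂ) := by
  have key (s : ℤ) : ∑ i, ((Pi.single h s : Fin n → ℤ) i : ℂ) * x i = s * x h := by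
    rw [Finset.sum_eq_single h]
    · simp
    · intro i _ hi
      simp [hi]
    · simp
  simp only [latticeChar, key, Complex.ofReal_cos, Complex.two_cos]
  push_cast
  congr 2 <;> ring

/-- Trigonometric polynomials of degree at most `m` in the nodes. -/
noncomputable def latticeSpan {n : ℕ} (x : Fin n → ℝ) (m : ℕ) : Submodule ℂ (ℤ → ℂ) :=
  Submodule.span ℂ (latticeChar x '' (latticeBall n m : Set (Fin n → ℤ)))

theorem latticeChar_mem {n m : ℕ} (x : Fin n → ℝ) {j : Fin n → ℤ}
    (hj : ∑ h, (j h).natAbs ≤ m) : latticeChar x j ∈ latticeSpan x m :=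
  Submodule.subset_span ⟨j, mem_latticeBall.2 hj, rfl⟩

theorem latticeSpan_mono {n : ℕ} (x : Fin n → ℝ) : Monotone (latticeSpan x) := by
  intro a b hab
  refine Submodule.span_mono (Set.image_mono fun j hj => ?_)
  exact mem_latticeBall.2 ((mem_latticeBall.1 hj).trans hab)

theorem mul_mem_latticeSpan {n a b : ℕ} {x : Fin n → ℝ} {f g : ℤ → ℂ}
    (hf : f ∈ latticeSpan x a) (hg : g ∈ latticeSpan x b) : f * g ∈ latticeSpan x (a + b) := by
  have h := Submodule.mul_mem_mul hf hg
  rw [latticeSpan, latticeSpan, Submodule.span_mul_span] at h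
  refine Submodule.span_mono ?_ h
  rintro _ ⟨_, ⟨i, hi, rfl⟩, _, ⟨j, hj, rfl⟩, rfl⟩
  refine ⟨i + j, mem_latticeBall.2 ?_, latticeChar_add x i j⟩
  calc ∑ h, ((i + j) h).natAbs ≤ ∑ h, ((i h).natAbs + (j h).natAbs) :=
        Finset.sum_le_sum fun h _ => Int.natAbs_add_le _ _
    _ ≤ a + b := by
        rw [Finset.sum_add_distrib]
        exact Nat.add_le_add (mem_latticeBall.1 hi) (mem_latticeBall.1 hj)

open Polynomial in
theorem chebyshev_comp_mem_latticeSpan {n : ℕ} {x : Fin n → ℝ} {f : ℤ → ℂ}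
    (hf : f ∈ latticeSpan x 1) (m : ℕ) :
    (aeval f (Chebyshev.T ℂ m)) ∈ latticeSpan x m := by
  induction m using Nat.twoStepInduction with
  | zero =>
    simp only [Nat.cast_zero, Chebyshev.T_zero, map_one]
    rw [← latticeChar_zero x]
    exact latticeChar_mem x (by simp)
  | one => simpa using hf
  | more m ih0 ih1 =>
    push_cast at ih1 ⊢
    rw [Chebyshev.T_add_two, map_sub, map_mul, map_mul, aeval_X, map_ofNat, mul_assoc]
    refine Submodule.sub_mem _ ?_ (latticeSpan_mono x (by omega) ih0)
    have h := mul_mem_latticeSpan hf ih1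
    rw [show 1 + (m + 1) = m + 2 by ring] at h
    have h2 := Submodule.smul_mem _ (2 : ℂ) h
    convert h2 using 1
    ext q
    simp

/-- A function in the span of few characters gives a Toeplitz matrix of small rank. -/
theorem rank_toeplitz_le {n m N : ℕ} {x : Fin n → ℝ} {F : ℤ → ℂ} (hF : F ∈ latticeSpan x m) :
    (Matrix.of fun i k : Fin N => F ((i : ℤ) - (k : ℤ))).rank ≤ delannoy n m := by
  classical
  refine le_trans ?_ (card_latticeBall_le n m)
  rw [latticeSpan] at hF
  obtain ⟨b, hb⟩ := (Submodule.mem_span_image_finset_iff_exists_fun ℂ).1 hF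
  have hA : (Matrix.of fun i k : Fin N => F ((i : ℤ) - (k : ℤ))) =
      (Matrix.of fun (i : Fin N) (j : latticeBall n m) => b j * latticeChar x j i) *
        (Matrix.of fun (j : latticeBall n m) (k : Fin N) => latticeChar x j (-(k : ℤ))) := by
    ext i k
    rw [Matrix.mul_apply]
    simp only [Matrix.of_apply]
    rw [← hb, Finset.sum_apply]
    refine Finset.sum_congr rfl fun j _ => ?_
    rw [Pi.smul_apply, smul_eq_mul, latticeChar_sub_apply, mul_assoc]
  rw [hA]
  refine (Matrix.rank_mul_le_left _ _).trans ?_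
  simpa using Matrix.rank_le_card_width
    (Matrix.of fun (i : Fin N) (j : latticeBall n m) => b j * latticeChar x j i)

theorem error_mem_latticeSpan {n : ℕ} (x c : Fin n → ℝ) :
    (fun q : ℤ => ((1 - ∑ h, c h * (1 - Real.cos (2 * π * q * x h)) : ℝ) : ℂ)) ∈
      latticeSpan x 1 := by
  have h0 : latticeChar x 0 ∈ latticeSpan x 1 := latticeChar_mem x (by simp)
  have h1 (s : ℤ) (hs : s.natAbs = 1) (h : Fin n) :
      latticeChar x (Pi.single h s) ∈ latticeSpan x 1 := by
    refine latticeChar_mem x ?_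
    rw [Finset.sum_eq_single h]
    · simp [hs]
    · intro i _ hi
      simp [hi]
    · simp
  have key : (fun q : ℤ => ((1 - ∑ h, c h * (1 - Real.cos (2 * π * q * x h)) : ℝ) : ℂ)) =
      latticeChar x 0 - ∑ h, (c h : ℂ) • (latticeChar x 0 - (1 / 2 : ℂ) •
        (latticeChar x (Pi.single h 1) + latticeChar x (Pi.single h (-1)))) := by
    ext q
    simp only [Pi.sub_apply, Finset.sum_apply, Pi.smul_apply, Pi.add_apply, smul_eq_mul,
      latticeChar_single_add_neg, latticeChar_zero, Pi.one_apply]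
    push_cast
    congr 1
    refine Finset.sum_congr rfl fun h _ => ?_
    ring
  rw [key]
  refine Submodule.sub_mem _ h0 (Submodule.sum_mem _ fun h _ => Submodule.smul_mem _ _ ?_)
  exact Submodule.sub_mem _ h0 (Submodule.smul_mem _ _
    (Submodule.add_mem _ (h1 1 rfl h) (h1 (-1) rfl h)))

open Polynomial in
theorem exists_chebyshev_error_mem_latticeSpan {n : ℕ} (x c : Fin n → ℝ) (m : ℕ) :
    ∃ F ∈ latticeSpan x m, ∀ q : ℤ, F q = (((Chebyshev.T ℝ m).eval
      (3 / 2 * (1 - ∑ h, c h * (1 - Real.cos (2 * π * q * x h)))) : ℝ) : ℂ) := by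
  set E : ℤ → ℝ := fun q => 1 - ∑ h, c h * (1 - Real.cos (2 * π * q * x h)) with hE
  refine ⟨aeval ((3 / 2 : ℂ) • fun q => (E q : ℂ)) (Chebyshev.T ℂ m),
    chebyshev_comp_mem_latticeSpan (Submodule.smul_mem _ _ (error_mem_latticeSpan x c)) m,
    fun q => ?_⟩
  have h := Polynomial.aeval_algHom_apply (Pi.evalAlgHom ℂ (fun _ : ℤ => ℂ) q)
    ((3 / 2 : ℂ) • fun q => (E q : ℂ)) (Chebyshev.T ℂ m)
  simp only [Pi.evalAlgHom_apply] at h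
  rw [← h, ← Chebyshev.map_T (algebraMap ℝ ℂ), aeval_map_algebraMap]
  rw [← Complex.coe_algebraMap, ← Polynomial.aeval_algebraMap_apply_eq_algebraMap_eval]
  congr 2
  simp [hE]

open Polynomial in
theorem exists_two_thirds_le_abs_error {n m N : ℕ}
    (hN : (delannoy n m : ℝ) * (N - 1) <
      (Chebyshev.T ℝ m).eval (3 / 2) ^ 2 * (N - delannoy n m)) (hN0 : 0 < N)
    (x c : Fin n → ℝ) :
    ∃ q : ℕ, 0 < q ∧ q < N ∧
      2 / 3 ≤ |1 - ∑ h, c h * (1 - Real.cos (2 * π * q * x h))| := by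
  by_contra! hcon
  set E : ℤ → ℝ := fun q => 1 - ∑ h, c h * (1 - Real.cos (2 * π * q * x h)) with hE
  set t : ℝ := (Chebyshev.T ℝ m).eval (3 / 2) with ht
  obtain ⟨F, hF, hFE⟩ := exists_chebyshev_error_mem_latticeSpan x c m
  change ∀ q, F q = (((Chebyshev.T ℝ m).eval (3 / 2 * E q) : ℝ) : ℂ) at hFE
  have hEneg (q : ℤ) : E (-q) = E q := by
    simp only [hE]
    congr 1
    refine Finset.sum_congr rfl fun h _ => ?_
    rw [← Real.cos_neg]
    push_cast
    ring_nf
  have hE0 : E 0 = 1 := by simp [hE]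
  have hF0 : F 0 = (t : ℂ) := by rw [hFE, hE0, mul_one]
  have hEnat (q : ℕ) (h0 : 0 < q) (h1 : q < N) : |E q| < 2 / 3 := by
    simpa [hE] using hcon q h0 h1
  have hEsmall (q : ℤ) (h0 : q ≠ 0) (h1 : q.natAbs < N) : |E q| < 2 / 3 := by
    rcases Int.natAbs_eq q with h | h <;> rw [h]
    · exact hEnat _ (Int.natAbs_pos.2 h0) h1
    · rw [hEneg]
      exact hEnat _ (Int.natAbs_pos.2 h0) h1
  let A : Matrix (Fin N) (Fin N) ℂ := Matrix.of fun i k : Fin N => F ((i : ℤ) - (k : ℤ))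
  have hrank : (A.rank : ℝ) ≤ delannoy n m := Nat.cast_le.2 (rank_toeplitz_le hF)
  have hA : A.IsHermitian := by
    refine Matrix.IsHermitian.ext fun i k => ?_
    simp only [A, Matrix.of_apply, hFE, RCLike.star_def, Complex.conj_ofReal]
    rw [← hEneg, neg_sub]
  have htr : A.trace.re = N * t := by
    simp [Matrix.trace, A, hF0]
  have hrow (i : Fin N) : ∑ k, ‖A i k‖ ^ 2 ≤ t ^ 2 + (N - 1) := by
    rw [← Finset.add_sum_erase _ _ (Finset.mem_univ i)]
    refine add_le_add ?_ ?_
    · simp [A, hF0]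
    · have hcard : ((Finset.univ.erase i).card : ℝ) = N - 1 := by
        rw [Finset.card_erase_of_mem (Finset.mem_univ i), Finset.card_univ, Fintype.card_fin,
          Nat.cast_pred hN0]
      rw [← hcard, ← nsmul_one]
      refine Finset.sum_le_card_nsmul _ _ _ fun k hk => ?_
      have hki : k ≠ i := Finset.ne_of_mem_erase hk
      have hki' : (k : ℕ) ≠ i := fun h => hki (Fin.ext h)
      have hs := hEsmall ((i : ℤ) - k) (by omega) (by omega)
      simp only [A, Matrix.of_apply, hFE, Complex.norm_real, Real.norm_eq_abs]
      refine pow_le_one₀ (abs_nonneg _) (Chebyshev.abs_eval_T_real_le_one m ?_)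
      rw [abs_mul, abs_of_pos (by norm_num : (0 : ℝ) < 3 / 2)]
      linarith
  have hsum : ∑ i, ∑ k, ‖A i k‖ ^ 2 ≤ N * (t ^ 2 + (N - 1)) := by
    refine (Finset.sum_le_sum fun i _ => hrow i).trans ?_
    rw [Finset.sum_const, Finset.card_univ, Fintype.card_fin, nsmul_eq_mul]
  have hmain := hA.re_trace_sq_le_rank_mul
  rw [htr] at hmain
  have hNpos : (0 : ℝ) < N := by exact_mod_cast hN0
  have hle : (N * t) ^ 2 ≤ delannoy n m * (N * (t ^ 2 + (N - 1))) :=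
    hmain.trans (mul_le_mul hrank hsum (by positivity) (by positivity))
  have hle' : (N : ℝ) * (N * t ^ 2) ≤ N * (delannoy n m * (t ^ 2 + (N - 1))) := by
    linarith
  have := le_of_mul_le_mul_left hle' hNpos
  linarith

open Polynomial in
theorem eval_chebyshev_three_halves_add_two (m : ℕ) :
    (Chebyshev.T ℝ ((m + 2 : ℕ) : ℤ)).eval (3 / 2) =
      3 * (Chebyshev.T ℝ ((m + 1 : ℕ) : ℤ)).eval (3 / 2) -
        (Chebyshev.T ℝ (m : ℤ)).eval (3 / 2) := by
  push_cast
  rw [Chebyshev.T_add_two]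
  simp only [eval_sub, eval_mul, eval_ofNat, eval_X]
  ring

/-- The Chebyshev values `T_m (3 / 2)`, doubled: every other Lucas number. -/
def lucasEven : ℕ → ℕ
  | 0 => 2
  | 1 => 3
  | m + 2 => 3 * lucasEven (m + 1) - lucasEven m

theorem lucasEven_le_succ (m : ℕ) : lucasEven m ≤ lucasEven (m + 1) := by
  induction m with
  | zero => simp [lucasEven]
  | succ m ih =>
    rw [lucasEven]
    omega

open Polynomial in
theorem eval_chebyshev_three_halves (m : ℕ) :
    (Chebyshev.T ℝ (m : ℤ)).eval (3 / 2) = lucasEven m / 2 := by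
  induction m using Nat.twoStepInduction with
  | zero => simp [lucasEven]
  | one => simp [lucasEven]
  | more m ih0 ih1 =>
    have h := lucasEven_le_succ m
    rw [eval_chebyshev_three_halves_add_two, ih0, ih1, lucasEven, Nat.cast_sub (by omega)]
    push_cast
    ring

theorem le_lucasEven_succ {m : ℕ} (hm : 3 ≤ m) :
    (13 / 5 : ℝ) * lucasEven m ≤ lucasEven (m + 1) := by
  induction m, hm using Nat.le_induction with
  | base => norm_num [lucasEven]
  | succ m _ ih =>
    have h := lucasEven_le_succ m
    rw [lucasEven, Nat.cast_sub (by omega)]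
    push_cast
    linarith

theorem pow_le_lucasEven {m : ℕ} (hm : 4 ≤ m) : (13 / 5 : ℝ) ^ m ≤ lucasEven m := by
  induction m, hm using Nat.le_induction with
  | base => norm_num [lucasEven]
  | succ m hm ih =>
    have h := le_lucasEven_succ (by omega : 3 ≤ m)
    rw [pow_succ]
    linarith

theorem delannoy_mul_lt {n : ℕ} (hn : 4 ≤ n) :
    (delannoy n n : ℝ) * (6 ^ n) < (lucasEven n / 2 : ℝ) ^ 2 * (6 ^ n + 1 - delannoy n n) := by
  rcases lt_or_ge n 17 with h | h
  · interval_cases n <;> norm_num [delannoy, lucasEven]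
  · have hd : (delannoy n n : ℝ) ≤ (35 / 6) ^ n := by
      refine (delannoy_le n n).trans (le_of_eq ?_)
      rw [← mul_pow]
      norm_num
    have hL : (169 / 25 : ℝ) ^ n ≤ (lucasEven n : ℝ) ^ 2 := by
      have := pow_le_pow_left₀ (by positivity) (pow_le_lucasEven hn) 2
      refine le_trans (le_of_eq ?_) this
      rw [← pow_mul, mul_comm n 2, pow_mul]
      norm_num
    have h1 : (35 / 36 : ℝ) ^ n ≤ 62 / 100 :=
      (pow_le_pow_of_le_one (by norm_num) (by norm_num) h).trans (by norm_num)
    have h2 : (12 : ℝ) ≤ (1014 / 875) ^ n :=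
      le_trans (by norm_num) (pow_le_pow_right₀ (by norm_num) h)
    have e1 : (35 / 6 : ℝ) ^ n = 6 ^ n * (35 / 36) ^ n := by rw [← mul_pow]; norm_num
    have e2 : (169 / 25 : ℝ) ^ n = (35 / 6) ^ n * (1014 / 875) ^ n := by
      rw [← mul_pow]; norm_num
    have h6 : (0 : ℝ) < 6 ^ n := by positivity
    have hp : (0 : ℝ) < (35 / 6) ^ n := by positivity
    have hgap : 38 / 100 * (6 : ℝ) ^ n ≤ 6 ^ n + 1 - delannoy n n := by
      nlinarith
    have hL' : 12 * (35 / 6 : ℝ) ^ n ≤ (lucasEven n : ℝ) ^ 2 := by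
      nlinarith
    calc (delannoy n n : ℝ) * 6 ^ n ≤ (35 / 6) ^ n * 6 ^ n := by gcongr
      _ < 3 * (35 / 6) ^ n * (38 / 100 * 6 ^ n) := by nlinarith [mul_pos hp h6]
      _ ≤ (lucasEven n / 2 : ℝ) ^ 2 * (6 ^ n + 1 - delannoy n n) := by
        refine mul_le_mul ?_ hgap (by positivity) (by positivity)
        linarith

theorem exists_two_thirds_le_abs_error_of_le {n : ℕ} (hn : 1 ≤ n) (x c : Fin n → ℝ) :
    ∃ q : ℕ, 0 < q ∧ q ≤ max 14 (6 ^ n) ∧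
      2 / 3 ≤ |1 - ∑ h, c h * (1 - Real.cos (2 * π * q * x h))| := by
  have key (m N : ℕ) (hN0 : 0 < N) (hNn : N ≤ max 14 (6 ^ n) + 1)
      (hN : (delannoy n m : ℝ) * (N - 1) < (lucasEven m / 2) ^ 2 * (N - delannoy n m)) :
      ∃ q : ℕ, 0 < q ∧ q ≤ max 14 (6 ^ n) ∧
        2 / 3 ≤ |1 - ∑ h, c h * (1 - Real.cos (2 * π * q * x h))| := by
    rw [← eval_chebyshev_three_halves] at hN
    obtain ⟨q, h0, h1, h2⟩ := exists_two_thirds_le_abs_error hN hN0 x c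
    exact ⟨q, h0, by omega, h2⟩
  rcases lt_or_ge n 4 with h | h
  · interval_cases n
    · exact key 2 15 (by norm_num) (by norm_num) (by norm_num [delannoy, lucasEven])
    · exact key 3 37 (by norm_num) (by norm_num) (by norm_num [delannoy, lucasEven])
    · exact key 4 217 (by norm_num) (by norm_num) (by norm_num [delannoy, lucasEven])
  · refine key n (6 ^ n + 1) (by positivity) (by omega) ?_
    have := delannoy_mul_lt h
    push_cast
    linarith

theorem seven_fourths_le_log_six : 7 / 4 ≤ Real.log 6 := by
  rw [Real.le_log_iff_exp_le (by norm_num)]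
  refine le_of_pow_le_pow_left₀ (n := 4) (by norm_num) (by norm_num) ?_
  rw [← Real.exp_nat_mul, show ((4 : ℕ) : ℝ) * (7 / 4) = (7 : ℕ) * 1 by norm_num,
    Real.exp_nat_mul]
  exact (pow_le_pow_left₀ (Real.exp_pos _).le Real.exp_one_lt_d9.le 7).trans (by norm_num)

theorem exp_five_ninths_le_log_six : Real.exp (5 / 9) ≤ Real.log 6 := by
  refine le_trans ?_ seven_fourths_le_log_six
  refine le_of_pow_le_pow_left₀ (n := 9) (by norm_num) (by norm_num) ?_
  rw [← Real.exp_nat_mul, show ((9 : ℕ) : ℝ) * (5 / 9) = (5 : ℕ) * 1 by norm_num,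
    Real.exp_nat_mul]
  exact (pow_le_pow_left₀ (Real.exp_pos _).le Real.exp_one_lt_d9.le 5).trans (by norm_num)

theorem log_log_le_one_of_le {q : ℕ} (hq : q ≤ 14) : Real.log (Real.log q) ≤ 1 := by
  rcases Nat.eq_zero_or_pos q with rfl | h0
  · simp
  have hlog : Real.log q ≤ 27 / 10 := by
    have hq' : (q : ℝ) ≤ 14 := by exact_mod_cast hq
    rw [Real.log_le_iff_le_exp (by exact_mod_cast h0)]
    refine hq'.trans (le_of_pow_le_pow_left₀ (n := 10) (by norm_num) (Real.exp_pos _).le ?_)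
    rw [← Real.exp_nat_mul, show ((10 : ℕ) : ℝ) * (27 / 10) = (27 : ℕ) * 1 by norm_num,
      Real.exp_nat_mul]
    exact le_trans (by norm_num)
      (pow_le_pow_left₀ (by norm_num) Real.exp_one_gt_d9.le 27)
  have hnonneg : 0 ≤ Real.log q := Real.log_natCast_nonneg q
  rcases hnonneg.eq_or_lt with h | h
  · simp [← h]
  · rw [Real.log_le_iff_le_exp h]
    linarith [Real.exp_one_gt_d9]

theorem max_one_log_log_le {n q : ℕ} (hq : q ≤ max 14 (6 ^ n)) :
    max 1 (Real.log (Real.log q)) ≤ max 1 (Real.log (n * Real.log 6)) := by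
  refine max_le (le_max_left _ _) ?_
  rcases le_max_iff.1 hq with h | h
  · exact (log_log_le_one_of_le h).trans (le_max_left _ _)
  rcases Nat.lt_or_ge 1 q with h1 | h1
  · refine le_trans ?_ (le_max_right _ _)
    refine Real.log_le_log (Real.log_pos (by exact_mod_cast h1)) ?_
    rw [← Real.log_pow]
    exact Real.log_le_log (by positivity) (by exact_mod_cast h)
  · exact (log_log_le_one_of_le (by omega)).trans (le_max_left _ _)

theorem one_sub_cos_le {k : ℕ} {ξ : ℝ} (h : |k * ξ - round (k * ξ)| ≤ 1 / 15) :
    1 - Real.cos (2 * π * k * ξ) ≤ 9 / 100 := by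
  have hcos : Real.cos (2 * π * k * ξ) = Real.cos (2 * π * (k * ξ - round (k * ξ))) := by
    rw [← Real.cos_sub_int_mul_two_pi (2 * π * k * ξ) (round (k * ξ))]
    congr 1
    ring
  rw [hcos]
  have h1 := Real.one_sub_sq_div_two_le_cos (x := 2 * π * (k * ξ - round (k * ξ)))
  have h2 : (k * ξ - round (k * ξ)) ^ 2 ≤ (1 / 15) ^ 2 := sq_le_sq' (by linarith [abs_le.1 h])
    (abs_le.1 h).2
  have h3 : π ^ 2 ≤ 3.15 ^ 2 := pow_le_pow_left₀ Real.pi_pos.le Real.pi_lt_d2.le 2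
  have h4 : π ^ 2 * (k * ξ - round (k * ξ)) ^ 2 ≤ 3.15 ^ 2 * (1 / 15) ^ 2 := by gcongr
  norm_num at h4
  linarith

/-- fooling-function lower bound for the weight
`r₀(k) = max(1, log log |k|)`, and the resulting exponential lower bound on the
number of nodes of any quadrature rule with worst-case error at most `ε` on the
unit ball of the corresponding weighted Wiener space. -/
theorem stmt_3 (n : ℕ) (hn : 1 ≤ n) (x : Fin n → ℝ) (hx : ∀ h, x h ∈ Set.Ico (0:ℝ) 1)
    (c : Fin n → ℝ) :
    (∃ (g : ℝ → ℝ) (W : ℝ),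
      (((g = fun _ => 1) ∧ W = 1) ∨
        (∃ q : ℕ, 0 < q ∧ (g = fun t => 1 - Real.cos (2 * π * q * t)) ∧
          W = 1 + max 1 (Real.log (Real.log q)))) ∧
      (2/3) / (1 + max 1 (Real.log (n * Real.log 6))) * W ≤ |1 - ∑ h, c h * g (x h)|) ∧
    (∀ ε : ℝ, ε ∈ Set.Ioo (0:ℝ) 1 →
      (∀ (g : ℝ → ℝ) (W : ℝ),
        (((g = fun _ => 1) ∧ W = 1) ∨
          (∃ q : ℕ, 0 < q ∧ (g = fun t => 1 - Real.cos (2 * π * q * t)) ∧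
            W = 1 + max 1 (Real.log (Real.log q)))) →
        |1 - ∑ h, c h * g (x h)| ≤ ε * W) →
      (1 / Real.log 6) * Real.exp (2 / (3 * ε) - 1) ≤ n) := by
  obtain ⟨q, hq0, hq, hqE⟩ := exists_two_thirds_le_abs_error_of_le hn x c
  have hW := max_one_log_log_le hq
  refine ⟨⟨fun t => 1 - Real.cos (2 * π * q * t), _, Or.inr ⟨q, hq0, rfl, rfl⟩, ?_⟩, ?_⟩
  · refine le_trans ?_ hqE
    have hM : (0 : ℝ) < 1 + max 1 (Real.log (n * Real.log 6)) := by positivity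
    rw [div_mul_eq_mul_div, div_le_iff₀ hM]
    linarith
  · intro ε hε herr
    have hε0 := hε.1
    have hlog6 := seven_fourths_le_log_six
    rw [one_div_mul_eq_div, div_le_iff₀ (by linarith)]
    rcases Nat.lt_or_ge n 2 with hn2 | hn2
    · obtain rfl : n = 1 := by omega
      have hone := herr (fun _ => 1) 1 (Or.inl ⟨rfl, rfl⟩)
      obtain ⟨k, hk0, hk, hkx⟩ :=
        Real.exists_nat_abs_mul_sub_round_le (x 0) (n := 14) (by norm_num)
      have herrk := herr (fun t => 1 - Real.cos (2 * π * k * t)) _ (Or.inr ⟨k, hk0, rfl, rfl⟩)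
      rw [max_eq_left (log_log_le_one_of_le hk)] at herrk
      simp only [Fin.sum_univ_one, mul_one] at hone herrk
      have hu := one_sub_cos_le (hkx.trans (by norm_num))
      have hu0 : 0 ≤ 1 - Real.cos (2 * π * k * x 0) := by
        linarith [Real.cos_le_one (2 * π * k * x 0)]
      have hc : c 0 ≤ 1 + ε := by linarith [(abs_le.1 hone).1]
      have hE := (abs_le.1 herrk).2
      have hcu : c 0 * (1 - Real.cos (2 * π * k * x 0)) ≤ (1 + ε) * (9 / 100) :=
        (mul_le_mul_of_nonneg_right hc hu0).trans (mul_le_mul_of_nonneg_left hu (by linarith))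
      have hε3 : 3 / 7 ≤ ε := by linarith
      have hexp : 2 / (3 * ε) - 1 ≤ 5 / 9 := by
        rw [sub_le_iff_le_add, div_le_iff₀ (by positivity)]
        linarith
      rw [Nat.cast_one, one_mul]
      exact (Real.exp_le_exp.2 hexp).trans exp_five_ninths_le_log_six
    · have hn2' : (2 : ℝ) ≤ n := by exact_mod_cast hn2
      have hnlog : Real.exp 1 ≤ n * Real.log 6 := by
        nlinarith [Real.exp_one_lt_d9]
      have hpos : 0 < n * Real.log 6 := (Real.exp_pos 1).trans_le hnlog
      rw [max_eq_right ((Real.le_log_iff_exp_le hpos).2 hnlog)] at hW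
      have herrq := hqE.trans
        (herr (fun t => 1 - Real.cos (2 * π * q * t)) _ (Or.inr ⟨q, hq0, rfl, rfl⟩))
      have hle : 2 / 3 ≤ ε * (1 + Real.log (n * Real.log 6)) :=
        herrq.trans (mul_le_mul_of_nonneg_left (by linarith) hε0.le)
      rw [← Real.le_log_iff_exp_le hpos, sub_le_iff_le_add, div_le_iff₀ (by positivity)]
      linarith
end

section
/- For every d ≥ 1 and every δ ∈ (0,1], the set A(δ, d) = {k ∈ ℤ^d \ {0} : ∏_{j=1}^d max(1, |k_j|) ≤ 1/δ} is finite, with |A(δ, d)| ≤ (4^d/δ)·(1 + log(1/δ))^{d−1}. -/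
theorem sum_Icc_neg_inv_max_one_abs (n : ℕ) :
    ∑ a ∈ Finset.Icc (-(n : ℤ)) n, (max 1 |(a : ℝ)|)⁻¹ = 1 + 2 * (harmonic n : ℝ) := by
  induction n with
  | zero => simp
  | succ n ih =>
    have hIcc : Finset.Icc (-((n + 1 : ℕ) : ℤ)) ((n + 1 : ℕ) : ℤ) =
        insert (-((n : ℤ) + 1)) (insert ((n : ℤ) + 1) (Finset.Icc (-(n : ℤ)) n)) := by
      ext a
      simp only [Finset.mem_Icc, Finset.mem_insert]
      push_cast
      omega
    have hmax : max (1 : ℝ) |(n : ℝ) + 1| = n + 1 := by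
      rw [abs_of_nonneg (by positivity), max_eq_right]
      linarith [(Nat.cast_nonneg n : (0 : ℝ) ≤ n)]
    rw [hIcc, Finset.sum_insert, Finset.sum_insert, ih, harmonic_succ]
    · push_cast
      rw [abs_neg, hmax]
      ring
    · simp
    · simp only [Finset.mem_Icc, Finset.mem_insert]
      omega

theorem abs_le_floor_of_max_one_abs_le {a : ℤ} {T : ℝ} (ha : max 1 |(a : ℝ)| ≤ T) :
    a ∈ Finset.Icc (-(⌊T⌋₊ : ℤ)) ⌊T⌋₊ := by
  have h : a.natAbs ≤ ⌊T⌋₊ := by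
    apply Nat.le_floor
    rw [Nat.cast_natAbs, Int.cast_abs]
    exact (le_max_right _ _).trans ha
  rw [Finset.mem_Icc]
  omega

theorem max_one_abs_le_of_mem_Icc_floor {a : ℤ} {T : ℝ} (hT : 1 ≤ T)
    (ha : a ∈ Finset.Icc (-(⌊T⌋₊ : ℤ)) ⌊T⌋₊) : max 1 |(a : ℝ)| ≤ T := by
  refine max_le hT ?_
  rw [Finset.mem_Icc] at ha
  have h : a.natAbs ≤ ⌊T⌋₊ := by omega
  rw [← Int.cast_abs, ← Nat.cast_natAbs]
  exact (Nat.cast_le.2 h).trans (Nat.floor_le (by linarith))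

/-- The integer points of a hyperbolic cross of level `T` in dimension `d + 1` lie in a finite set
of cardinality at most `3 ^ (d + 1) * T * (1 + log T) ^ d`. -/
theorem exists_finset_hyperbolicCross (d : ℕ) : ∀ T : ℝ, 1 ≤ T →
    ∃ F : Finset (Fin (d + 1) → ℤ), (∀ k, (∏ j, max 1 |(k j : ℝ)|) ≤ T → k ∈ F) ∧
      (F.card : ℝ) ≤ 3 ^ (d + 1) * T * (1 + Real.log T) ^ d := by
  induction d with
  | zero =>
    intro T hT
    refine ⟨(Finset.Icc (-(⌊T⌋₊ : ℤ)) ⌊T⌋₊).image fun a _ ↦ a, fun k hk ↦ ?_, ?_⟩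
    · rw [Finset.mem_image]
      refine ⟨k 0, abs_le_floor_of_max_one_abs_le (by simpa using hk), ?_⟩
      ext j
      rw [Fin.fin_one_eq_zero j]
    · have hcard : ((Finset.Icc (-(⌊T⌋₊ : ℤ)) ⌊T⌋₊).image
          fun a (_ : Fin (0 + 1)) ↦ a).card ≤ 2 * ⌊T⌋₊ + 1 := by
        refine Finset.card_image_le.trans ?_
        rw [Int.card_Icc]
        omega
      have hcard' : (_ : ℝ) ≤ _ := Nat.cast_le.2 hcard
      push_cast at hcard'
      have := Nat.floor_le (zero_le_one.trans hT)
      simp only [zero_add, pow_one, pow_zero, mul_one] at hcard' ⊢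
      linarith
  | succ d ih =>
    intro T hT
    choose! F hF hFcard using ih
    have hlog : 0 ≤ Real.log T := Real.log_nonneg hT
    refine ⟨(Finset.Icc (-(⌊T⌋₊ : ℤ)) ⌊T⌋₊).biUnion fun a ↦
      (F (T / max 1 |(a : ℝ)|)).image (Fin.cons a), fun k hk ↦ ?_, ?_⟩
    · rw [Fin.prod_univ_succ] at hk
      have hpos : 0 < max 1 |(k 0 : ℝ)| := zero_lt_one.trans_le (le_max_left _ _)
      have htail : 1 ≤ ∏ j : Fin (d + 1), max 1 |(k j.succ : ℝ)| :=
        Finset.one_le_prod fun _ _ ↦ le_max_left _ _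
      have hk0 : max 1 |(k 0 : ℝ)| ≤ T := (le_mul_of_one_le_right hpos.le htail).trans hk
      rw [Finset.mem_biUnion]
      refine ⟨k 0, abs_le_floor_of_max_one_abs_le hk0, ?_⟩
      rw [Finset.mem_image]
      refine ⟨Fin.tail k, hF _ ((one_le_div hpos).2 hk0) _ ?_, Fin.cons_self_tail k⟩
      rw [le_div_iff₀' hpos]
      exact hk
    · have hslice : ∀ a ∈ Finset.Icc (-(⌊T⌋₊ : ℤ)) ⌊T⌋₊,
          (((F (T / max 1 |(a : ℝ)|)).image (Fin.cons a : _ → Fin (d + 2) → ℤ)).card : ℝ) ≤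
            3 ^ (d + 1) * T * (1 + Real.log T) ^ d * (max 1 |(a : ℝ)|)⁻¹ := by
        intro a ha
        have hone : 1 ≤ max 1 |(a : ℝ)| := le_max_left _ _
        have hpos : 0 < max 1 |(a : ℝ)| := zero_lt_one.trans_le hone
        have hquot : 1 ≤ T / max 1 |(a : ℝ)| :=
          (one_le_div hpos).2 (max_one_abs_le_of_mem_Icc_floor hT ha)
        have hquot_le : T / max 1 |(a : ℝ)| ≤ T := div_le_self (by linarith) hone
        have hlogquot : 0 ≤ Real.log (T / max 1 |(a : ℝ)|) := Real.log_nonneg hquot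
        calc (((F (T / max 1 |(a : ℝ)|)).image (Fin.cons a : _ → Fin (d + 2) → ℤ)).card : ℝ)
            ≤ (F (T / max 1 |(a : ℝ)|)).card := Nat.cast_le.2 Finset.card_image_le
          _ ≤ 3 ^ (d + 1) * (T / max 1 |(a : ℝ)|) *
                (1 + Real.log (T / max 1 |(a : ℝ)|)) ^ d := hFcard _ hquot
          _ ≤ 3 ^ (d + 1) * (T / max 1 |(a : ℝ)|) * (1 + Real.log T) ^ d := by gcongr
          _ = _ := by rw [div_eq_mul_inv]; ring
      have hsum : ∑ a ∈ Finset.Icc (-(⌊T⌋₊ : ℤ)) ⌊T⌋₊, (max 1 |(a : ℝ)|)⁻¹ ≤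
          3 * (1 + Real.log T) := by
        rw [sum_Icc_neg_inv_max_one_abs]
        linarith [harmonic_floor_le_one_add_log T hT]
      calc _ ≤ ((∑ a ∈ Finset.Icc (-(⌊T⌋₊ : ℤ)) ⌊T⌋₊,
              ((F (T / max 1 |(a : ℝ)|)).image
                (Fin.cons a : _ → Fin (d + 2) → ℤ)).card : ℕ) : ℝ) :=
            Nat.cast_le.2 Finset.card_biUnion_le
        _ ≤ ∑ a ∈ Finset.Icc (-(⌊T⌋₊ : ℤ)) ⌊T⌋₊,
              3 ^ (d + 1) * T * (1 + Real.log T) ^ d * (max 1 |(a : ℝ)|)⁻¹ := by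
            rw [Nat.cast_sum]
            exact Finset.sum_le_sum hslice
        _ ≤ 3 ^ (d + 1) * T * (1 + Real.log T) ^ d * (3 * (1 + Real.log T)) := by
            rw [← Finset.mul_sum]
            gcongr
        _ = _ := by ring


/-- the set `A(δ,d)` of nonzero frequencies with product weight
`r₄(k) = ∏_j max(1,|k_j|)` at most `1/δ` is finite, with
`|A(δ,d)| ≤ (4^d/δ)(1 + log(1/δ))^{d-1}`. -/
theorem stmt_14 (d : ℕ) (hd : 1 ≤ d) (δ : ℝ) (hδ : δ ∈ Set.Ioc (0:ℝ) 1) :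
    {k : Fin d → ℤ | k ≠ 0 ∧ (∏ j, max 1 |(k j : ℝ)|) ≤ 1 / δ}.Finite ∧
    (({k : Fin d → ℤ | k ≠ 0 ∧ (∏ j, max 1 |(k j : ℝ)|) ≤ 1 / δ}.ncard : ℝ))
      ≤ 4 ^ d / δ * (1 + Real.log (1 / δ)) ^ (d - 1) := by
  obtain ⟨hδ0, hδ1⟩ := hδ
  obtain ⟨d, rfl⟩ := Nat.exists_eq_add_of_le' hd
  have hT : 1 ≤ 1 / δ := (one_le_div hδ0).2 hδ1
  have hlog : 0 ≤ Real.log (1 / δ) := Real.log_nonneg hT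
  obtain ⟨F, hF, hcard⟩ := exists_finset_hyperbolicCross d (1 / δ) hT
  have hsub : {k : Fin (d + 1) → ℤ | k ≠ 0 ∧ (∏ j, max 1 |(k j : ℝ)|) ≤ 1 / δ} ⊆ F :=
    fun k hk ↦ hF k hk.2
  refine ⟨F.finite_toSet.subset hsub, ?_⟩
  have hncard := Set.ncard_le_ncard hsub F.finite_toSet
  rw [Set.ncard_coe_finset] at hncard
  refine (Nat.cast_le.2 hncard).trans (hcard.trans ?_)
  rw [Nat.add_sub_cancel, div_eq_mul_one_div (4 ^ (d + 1)) δ]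
  gcongr
  norm_num
end

section
/- Let d ≥ 1, let m ≥ 2 be an integer, and let c ∈ (0,1] be such that |P_m| ≥ c·m/log m, where P_m = {p prime : ⌈m/2⌉ < p ≤ m}. Then for every k ∈ ℤ^d \ {0}: (1/|P_m|) ∑_{p∈P_m} (p−1)^{−d} · #{z ∈ {1,…,p−1}^d : ∑_{j=1}^d k_j z_j ≡ 0 (mod p)} ≤ (4/(c·m)) · max(1, min_{j∈supp(k)} log|k_j|). -/
/-- The support of a frequency vector `k ∈ ℤ^d`. -/
def suppF {d : ℕ} (k : Fin d → ℤ) : Finset (Fin d) :=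
  Finset.univ.filter fun j => k j ≠ 0

/-- The weight `r₁(k) = max(1, log min_{j∈supp k} |k_j|)`, with `r₁(0) = 1`. -/
noncomputable def r1 {d : ℕ} (k : Fin d → ℤ) : ℝ :=
  if h : (suppF k).Nonempty then
    max 1 (Real.log ((((suppF k).inf' h fun j => (k j).natAbs) : ℕ) : ℝ))
  else 1

/-- The primes `p` with `⌈m/2⌉ < p ≤ m`. -/
def primesP (m : ℕ) : Finset ℕ := (Finset.Ioc ((m + 1) / 2) m).filter Nat.Prime

/-- If a prime `p` does not divide `k i`, then all but the `i`-th coordinate determine a solution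
`z ∈ {1,…,p-1}^ι` of `k·z ≡ 0 (mod p)`. -/
theorem card_filter_dvd_sum_le {ι : Type*} [Fintype ι] [DecidableEq ι] {p : ℕ} (hp : p.Prime)
    (k : ι → ℤ) (i : ι) (hi : ¬ (p : ℤ) ∣ k i) :
    ((Fintype.piFinset fun _ : ι => Finset.Icc 1 (p - 1)).filter
      fun z : ι → ℕ => (p : ℤ) ∣ ∑ j, k j * (z j : ℤ)).card ≤ (p - 1) ^ (Fintype.card ι - 1) := by
  have hcard : (Fintype.piFinset fun _ : {j : ι // j ≠ i} => Finset.Icc 1 (p - 1)).card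
      = (p - 1) ^ (Fintype.card ι - 1) := by
    simp [Fintype.card_subtype_compl]
  rw [← hcard]
  refine Finset.card_le_card_of_injOn (fun z j => z j) ?_ ?_
  · intro z hz
    simp only [Finset.coe_filter, Set.mem_ofPred_eq, Fintype.mem_piFinset] at hz
    simpa only [Finset.mem_coe, Fintype.mem_piFinset] using fun j : {j : ι // j ≠ i} => hz.1 j
  · intro z hz w hw hzw
    simp only [Finset.coe_filter, Set.mem_ofPred_eq, Fintype.mem_piFinset, Finset.mem_Icc] at hz hw
    have hoff : ∀ j, j ≠ i → z j = w j := fun j hj => congrFun hzw ⟨j, hj⟩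
    have hsum : (∑ j, k j * (z j : ℤ)) - ∑ j, k j * (w j : ℤ) = k i * ((z i : ℤ) - w i) := by
      rw [← Finset.sum_sub_distrib, Finset.sum_eq_single i]
      · ring
      · intro j _ hj
        rw [hoff j hj, sub_self]
      · simp
    have hdvd : (p : ℤ) ∣ (z i : ℤ) - w i :=
      ((Nat.prime_iff_prime_int.mp hp).dvd_or_dvd (hsum ▸ dvd_sub hz.2 hw.2)).resolve_left hi
    have hlt : |(z i : ℤ) - w i| < p := by
      have h1 := hz.1 i
      have h2 := hw.1 i
      rw [abs_lt]
      omega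
    have hzero := Int.eq_zero_of_abs_lt_dvd hdvd hlt
    funext j
    by_cases hj : j = i
    · subst hj
      omega
    · exact hoff j hj

/-- The primes of `P_m` that divide a given positive integer `n` are few. -/
theorem card_primesP_filter_dvd_mul_log_le {m n : ℕ} (hm : 0 < m) (hn : n ≠ 0) :
    (((primesP m).filter (· ∣ n)).card : ℝ) * Real.log m ≤ 2 * Real.log n := by
  have hprod : ∏ p ∈ (primesP m).filter (· ∣ n), p ≤ n := by
    refine Nat.le_of_dvd (Nat.pos_of_ne_zero hn) (Finset.prod_primes_dvd n ?_ ?_)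
    · intro p hp
      simp only [primesP, Finset.mem_filter] at hp
      exact hp.1.2.prime
    · intro p hp
      exact (Finset.mem_filter.mp hp).2
  have hpow : m ^ ((primesP m).filter (· ∣ n)).card ≤ n ^ 2 := by
    calc m ^ ((primesP m).filter (· ∣ n)).card
        ≤ ∏ p ∈ (primesP m).filter (· ∣ n), p ^ 2 := by
          rw [← Finset.prod_const]
          refine Finset.prod_le_prod' fun p hp => ?_
          simp only [primesP, Finset.mem_filter, Finset.mem_Ioc] at hp
          have h2 := hp.1.2.two_le
          have hmp : m ≤ 2 * p := by omega
          nlinarith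
      _ = (∏ p ∈ (primesP m).filter (· ∣ n), p) ^ 2 := Finset.prod_pow _ _ _
      _ ≤ n ^ 2 := Nat.pow_le_pow_left hprod 2
  have hlog := Real.log_le_log (by positivity)
    (by exact_mod_cast hpow : (m : ℝ) ^ ((primesP m).filter (· ∣ n)).card ≤ (n : ℝ) ^ 2)
  rw [Real.log_pow, Real.log_pow] at hlog
  exact_mod_cast hlog

/-- The weight `r₁(k)` is governed by some coordinate in the support of `k`. -/
theorem exists_ne_zero_and_r1_eq {d : ℕ} {k : Fin d → ℤ} (hk : k ≠ 0) :
    ∃ i, k i ≠ 0 ∧ r1 k = max 1 (Real.log ((k i).natAbs : ℝ)) := by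
  have hne : (suppF k).Nonempty := by
    obtain ⟨j, hj⟩ := Function.ne_iff.mp hk
    exact ⟨j, by simpa [suppF] using hj⟩
  obtain ⟨i, hi, hmin⟩ := Finset.exists_mem_eq_inf' hne fun j => (k j).natAbs
  refine ⟨i, by simpa [suppF] using hi, ?_⟩
  rw [r1, dif_pos hne, hmin]

/-- The proportion of solutions of `k·z ≡ 0 (mod p)` is at most `2/m`, unless `p` divides the
chosen coefficient `k i`. -/
theorem proportion_le {d m p : ℕ} (hm : 0 < m) (hp : p ∈ primesP m) (k : Fin d → ℤ) (i : Fin d) :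
    (1 / ((p : ℝ) - 1) ^ d) *
        ((((Fintype.piFinset fun _ : Fin d => Finset.Icc 1 (p - 1)).filter
            fun z : Fin d → ℕ => (p : ℤ) ∣ ∑ j, k j * (z j : ℤ)).card : ℝ))
      ≤ 2 / m + if p ∣ (k i).natAbs then 1 else 0 := by
  simp only [primesP, Finset.mem_filter, Finset.mem_Ioc] at hp
  obtain ⟨⟨hmp, -⟩, hprime⟩ := hp
  have hm' : (0 : ℝ) < m := by exact_mod_cast hm
  have hcast : ((p - 1 : ℕ) : ℝ) = (p : ℝ) - 1 := by
    rw [Nat.cast_sub hprime.one_le, Nat.cast_one]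
  have hhalf : (m : ℝ) ≤ 2 * ((p : ℝ) - 1) := by
    rw [← hcast]
    exact_mod_cast (by omega : m ≤ 2 * (p - 1))
  have hpos : (0 : ℝ) < (p : ℝ) - 1 := by linarith
  rw [one_div_mul_eq_div, div_le_iff₀ (by positivity)]
  split_ifs with hdvd
  · have hle : ((((Fintype.piFinset fun _ : Fin d => Finset.Icc 1 (p - 1)).filter
        fun z : Fin d → ℕ => (p : ℤ) ∣ ∑ j, k j * (z j : ℤ)).card : ℝ)) ≤ ((p : ℝ) - 1) ^ d := by
      rw [← hcast]
      exact_mod_cast (Finset.card_filter_le _ _).trans_eq (by simp)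
    have : (0 : ℝ) ≤ 2 / m * ((p : ℝ) - 1) ^ d := by positivity
    linarith
  · have hle := card_filter_dvd_sum_le hprime k i (by rwa [Int.natCast_dvd])
    rw [Fintype.card_fin] at hle
    have hle' : ((((Fintype.piFinset fun _ : Fin d => Finset.Icc 1 (p - 1)).filter
        fun z : Fin d → ℕ => (p : ℤ) ∣ ∑ j, k j * (z j : ℤ)).card : ℝ))
        ≤ ((p : ℝ) - 1) ^ (d - 1) := by
      rw [← hcast]
      exact_mod_cast hle
    have hd : ((p : ℝ) - 1) ^ d = ((p : ℝ) - 1) ^ (d - 1) * ((p : ℝ) - 1) := by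
      rw [← pow_succ, Nat.sub_add_cancel i.pos]
    refine hle'.trans ?_
    have hone : 1 ≤ 2 / (m : ℝ) * ((p : ℝ) - 1) := by
      rw [div_mul_eq_mul_div, le_div_iff₀ hm']
      linarith
    rw [hd, add_zero]
    calc ((p : ℝ) - 1) ^ (d - 1) = ((p : ℝ) - 1) ^ (d - 1) * 1 := (mul_one _).symm
      _ ≤ ((p : ℝ) - 1) ^ (d - 1) * (2 / (m : ℝ) * ((p : ℝ) - 1)) := by gcongr
      _ = 2 / (m : ℝ) * (((p : ℝ) - 1) ^ (d - 1) * ((p : ℝ) - 1)) := by ring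

/-- the average, over random `p ∈ P_m` and random generating vector
`z ∈ {1,…,p-1}^d`, of the proportion of `z` with `k·z ≡ 0 (mod p)` is at most
`(4/(c·m)) · r₁(k)`. -/
theorem stmt_18 (d : ℕ) (hd : 1 ≤ d) (m : ℕ) (hm : 2 ≤ m)
    (c : ℝ) (hc : c ∈ Set.Ioc (0:ℝ) 1)
    (hcard : c * m / Real.log m ≤ ((primesP m).card : ℝ))
    (k : Fin d → ℤ) (hk : k ≠ 0) :
    (1 / ((primesP m).card : ℝ)) * ∑ p ∈ primesP m, (1 / ((p : ℝ) - 1) ^ d) *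
        ((((Fintype.piFinset fun _ : Fin d => Finset.Icc 1 (p - 1)).filter
            fun z : Fin d → ℕ => (p : ℤ) ∣ ∑ j, k j * (z j : ℤ)).card : ℝ))
      ≤ (4 / (c * m)) * r1 k := by

  obtain ⟨hc0, hc1⟩ := hc
  obtain ⟨i, hi, hr⟩ := exists_ne_zero_and_r1_eq hk
  have hm0 : (0 : ℝ) < m := by exact_mod_cast (by omega : 0 < m)
  have hlog : 0 < Real.log m := Real.log_pos (by exact_mod_cast (by omega : 1 < m))
  have hP : (0 : ℝ) < ((primesP m).card : ℝ) := lt_of_lt_of_le (by positivity) hcard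
  rw [div_le_iff₀ hlog] at hcard
  have hfew := card_primesP_filter_dvd_mul_log_le (m := m) (by omega) (Int.natAbs_ne_zero.mpr hi)
  have hr1 : 1 ≤ r1 k := hr ▸ le_max_left _ _
  have hrlog : Real.log ((k i).natAbs : ℝ) ≤ r1 k := hr ▸ le_max_right _ _
  have hsum := Finset.sum_le_sum fun p hp => proportion_le (m := m) (by omega) hp k i
  rw [Finset.sum_add_distrib, Finset.sum_const, nsmul_eq_mul, Finset.sum_boole] at hsum
  rw [one_div_mul_eq_div, div_le_iff₀ hP]
  refine hsum.trans ?_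
  set P : ℝ := ((primesP m).card : ℝ)
  set N : ℝ := (((primesP m).filter (· ∣ (k i).natAbs)).card : ℝ)
  have hmain : P * (2 / m) ≤ 2 / (c * m) * r1 k * P := by
    have : 2 / (m : ℝ) ≤ 2 / (c * m) * r1 k := by
      rw [div_mul_eq_mul_div, div_le_div_iff₀ hm0 (by positivity)]
      have : c * m ≤ r1 k * m := by gcongr; linarith
      linarith
    rw [mul_comm]
    gcongr
  have hexc : N ≤ 2 / (c * m) * r1 k * P := by
    have hcm : 0 < c * m := by positivity
    rw [div_mul_eq_mul_div, div_mul_eq_mul_div, le_div_iff₀ hcm]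
    calc N * (c * m) ≤ N * (P * Real.log m) := by gcongr
      _ = N * Real.log m * P := by ring
      _ ≤ 2 * r1 k * P := mul_le_mul_of_nonneg_right (by linarith) hP.le
  calc P * (2 / m) + N ≤ 2 / (c * m) * r1 k * P + 2 / (c * m) * r1 k * P := add_le_add hmain hexc
    _ = 4 / (c * m) * r1 k * P := by ring
end
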